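/- Let m > 0 and ε > 0, and let h ∈ C^∞(ℝ) satisfy 0 ≤ h ≤ 1, h(ω) = 0 for |ω| ≤ m+ε, and h(ω) = 1 for |ω| ≥ m+2ε. For |ω| > m set k(ω) := sgn(ω)√(ω²−m²) and define the matrix kernel D_ω(z) := α sin(k(ω)z) + i(mβ + ωI) cos(k(ω)z)/k(ω), which is the jump of the free Dirac resolvent across its continuous spectrum: D_ω = kernel of R₀(ω+i0) − R₀(ω−i0). Then for every σ > 5/2 there is a constant C such that for every Schwartz function f : ℝ → ℂ² and every t ∈ ℝ, the improper integral (U_h(t)f)(x) := (1/2πi) lim_{N→∞} ∫_{m<|ω|<N} e^{−iωt} h(ω) (∫_ℝ D_ω(x−y) f(y) dy) dω converges in L²_{−σ}(ℝ; ℂ²) and satisfies ‖U_h(t)f‖_{L²_{−σ}} ≤ C(1+|t|)^{−3/2} ‖f‖_{L²_σ}. (This is the t^{−3/2} decay of the high-energy component of the free 1D Dirac group e^{−itH₀}, H₀ = iα d/dx + mβ.) -/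

import Mathlib

noncomputable section

open MeasureTheory
open scoped ENNReal NNReal

/-- The Dirac matrix `α = [[-1,0],[0,1]]`. -/
def Mα : Matrix (Fin 2) (Fin 2) ℂ := !![-1, 0; 0, 1]

/-- The Dirac matrix `β = [[0,1],[1,0]]`. -/
def Mβ : Matrix (Fin 2) (Fin 2) ℂ := !![0, 1; 1, 0]

/-- The jump `D_ω(z) = α sin(k(ω)z) + i(mβ + ωI) cos(k(ω)z)/k(ω)` of the free Dirac
resolvent kernel across the continuous spectrum, with `k(ω) = sgn(ω)√(ω²−m²)`. -/
def Dmat (m ω z : ℝ) : Matrix (Fin 2) (Fin 2) ℂ :=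
  ((Real.sin (Real.sign ω * Real.sqrt (ω ^ 2 - m ^ 2) * z) : ℝ) : ℂ) • Mα
    + (Complex.I * (((Real.cos (Real.sign ω * Real.sqrt (ω ^ 2 - m ^ 2) * z) : ℝ) : ℂ)
        / ((Real.sign ω * Real.sqrt (ω ^ 2 - m ^ 2) : ℝ) : ℂ))) •
      ((m : ℂ) • Mβ + (ω : ℂ) • (1 : Matrix (Fin 2) (Fin 2) ℂ))

open scoped FourierTransform SchwartzMap

/-- The signed dispersion relation `ξ ↦ sgn(ξ) √((2πξ)² + m²)`, inverse to
`ω ↦ sgn(ω) √(ω² − m²) / 2π`. -/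
def dispersion (m ξ : ℝ) : ℝ := Real.sign ξ * √((2 * Real.pi * ξ) ^ 2 + m ^ 2)

/-- The group velocity, i.e. the derivative of `dispersion`. -/
def velocity (m ξ : ℝ) : ℝ := 4 * Real.pi ^ 2 * ξ / dispersion m ξ

lemma sign_mul_self_of_ne_zero {ξ : ℝ} (hξ : ξ ≠ 0) : Real.sign ξ * Real.sign ξ = 1 := by
  rcases Real.sign_apply_eq_of_ne_zero ξ hξ with h | h <;> simp [h]

lemma dispersion_zero (m : ℝ) : dispersion m 0 = 0 := by simp [dispersion]

lemma dispersion_neg (m ξ : ℝ) : dispersion m (-ξ) = -dispersion m ξ := by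
  simp [dispersion, Real.sign_neg]

lemma abs_dispersion (m : ℝ) {ξ : ℝ} (hξ : ξ ≠ 0) :
    |dispersion m ξ| = √((2 * Real.pi * ξ) ^ 2 + m ^ 2) := by
  rw [dispersion, abs_mul, abs_of_nonneg (Real.sqrt_nonneg _)]
  rcases Real.sign_apply_eq_of_ne_zero ξ hξ with h | h <;> simp [h]

lemma dispersion_sq (m : ℝ) {ξ : ℝ} (hξ : ξ ≠ 0) :
    dispersion m ξ ^ 2 = (2 * Real.pi * ξ) ^ 2 + m ^ 2 := by
  rw [← sq_abs, abs_dispersion m hξ, Real.sq_sqrt (by positivity)]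

lemma lt_abs_dispersion (m : ℝ) {ξ : ℝ} (hξ : ξ ≠ 0) : m < |dispersion m ξ| := by
  rw [abs_dispersion m hξ]
  apply Real.lt_sqrt_of_sq_lt
  have : 0 < (2 * Real.pi * ξ) ^ 2 := by positivity
  linarith

lemma dispersion_ne_zero {m : ℝ} (hm : 0 < m) {ξ : ℝ} (hξ : ξ ≠ 0) : dispersion m ξ ≠ 0 :=
  abs_pos.1 (hm.trans (lt_abs_dispersion m hξ))

lemma sign_dispersion {m : ℝ} (hm : 0 < m) {ξ : ℝ} (hξ : ξ ≠ 0) :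
    Real.sign (dispersion m ξ) = Real.sign ξ := by
  have hpos : 0 < √((2 * Real.pi * ξ) ^ 2 + m ^ 2) :=
    Real.sqrt_pos.2 (add_pos_of_nonneg_of_pos (sq_nonneg _) (pow_pos hm 2))
  rcases lt_or_gt_of_ne hξ with h | h
  · rw [Real.sign_of_neg h, Real.sign_of_neg]
    simpa [dispersion, Real.sign_of_neg h] using hpos
  · rw [Real.sign_of_pos h, Real.sign_of_pos]
    simpa [dispersion, Real.sign_of_pos h] using hpos

lemma sign_mul_sqrt_dispersion {m : ℝ} (hm : 0 < m) {ξ : ℝ} (hξ : ξ ≠ 0) :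
    Real.sign (dispersion m ξ) * √(dispersion m ξ ^ 2 - m ^ 2) = 2 * Real.pi * ξ := by
  rw [sign_dispersion hm hξ, dispersion_sq m hξ, add_sub_cancel_right, Real.sqrt_sq_eq_abs]
  rcases lt_or_gt_of_ne hξ with h | h
  · rw [Real.sign_of_neg h, abs_of_neg (mul_neg_of_pos_of_neg (by positivity) h)]
    ring
  · rw [Real.sign_of_pos h, abs_of_pos (by positivity)]
    ring

lemma dispersion_sign_mul_sqrt {m : ℝ} (hm : 0 < m) {ω : ℝ} (hω : m < |ω|) :
    dispersion m (Real.sign ω * √(ω ^ 2 - m ^ 2) / (2 * Real.pi)) = ω := by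
  have hω0 : ω ≠ 0 := abs_pos.1 (hm.trans hω)
  have hsq : 0 < ω ^ 2 - m ^ 2 := by
    rw [← sq_abs ω]
    nlinarith
  have hs := sign_mul_self_of_ne_zero hω0
  have h1 : (2 * Real.pi * (Real.sign ω * √(ω ^ 2 - m ^ 2) / (2 * Real.pi))) ^ 2 + m ^ 2
      = ω ^ 2 := by
    rw [mul_div_cancel₀ _ (by positivity), mul_pow, Real.sq_sqrt hsq.le]
    linear_combination (ω ^ 2 - m ^ 2) * hs
  have h2 : Real.sign (Real.sign ω * √(ω ^ 2 - m ^ 2) / (2 * Real.pi)) = Real.sign ω := by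
    have hpos : 0 < √(ω ^ 2 - m ^ 2) / (2 * Real.pi) := by positivity
    rw [mul_div_assoc]
    rcases lt_or_gt_of_ne hω0 with h | h
    · rw [Real.sign_of_neg h, Real.sign_of_neg (by linarith)]
    · rw [Real.sign_of_pos h, Real.sign_of_pos (by linarith)]
  rw [dispersion, h1, h2, Real.sqrt_sq_eq_abs]
  rcases lt_or_gt_of_ne hω0 with h | h
  · rw [Real.sign_of_neg h, abs_of_neg h]
    ring
  · rw [Real.sign_of_pos h, abs_of_pos h]
    ring

lemma hasDerivAt_dispersion {m : ℝ} (hm : 0 < m) {ξ : ℝ} (hξ : ξ ≠ 0) :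
    HasDerivAt (dispersion m) (velocity m ξ) ξ := by
  have hpos : 0 < (2 * Real.pi * ξ) ^ 2 + m ^ 2 := by positivity
  have h1 : HasDerivAt (fun x : ℝ => (2 * Real.pi * x) ^ 2 + m ^ 2)
      (2 * (2 * Real.pi * ξ) * (2 * Real.pi)) ξ := by
    simpa using ((((hasDerivAt_id ξ).const_mul (2 * Real.pi)).pow 2).add_const (m ^ 2))
  have h2 := (h1.sqrt hpos.ne').const_mul (Real.sign ξ)
  have hs := sign_mul_self_of_ne_zero hξ
  have hs0 : Real.sign ξ ≠ 0 := fun h => by simp [h] at hs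
  have h3 : (fun x => Real.sign ξ * √((2 * Real.pi * x) ^ 2 + m ^ 2)) =ᶠ[nhds ξ]
      dispersion m := by
    rcases lt_or_gt_of_ne hξ with h | h
    · filter_upwards [Iio_mem_nhds h] with x hx
      rw [dispersion, Real.sign_of_neg h, Real.sign_of_neg hx]
    · filter_upwards [Ioi_mem_nhds h] with x hx
      rw [dispersion, Real.sign_of_pos h, Real.sign_of_pos hx]
  refine (h2.congr_of_eventuallyEq h3.symm).congr_deriv ?_
  rw [velocity, dispersion]
  have : √((2 * Real.pi * ξ) ^ 2 + m ^ 2) ≠ 0 := by positivity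
  field_simp
  linear_combination 4 * hs

lemma velocity_pos {m : ℝ} (hm : 0 < m) {ξ : ℝ} (hξ : ξ ≠ 0) : 0 < velocity m ξ := by
  have hpos : 0 < √((2 * Real.pi * ξ) ^ 2 + m ^ 2) := by positivity
  rw [velocity, dispersion]
  rcases lt_or_gt_of_ne hξ with h | h
  · rw [Real.sign_of_neg h]
    apply div_pos_of_neg_of_neg
    · exact mul_neg_of_pos_of_neg (by positivity) h
    · linarith
  · rw [Real.sign_of_pos h]
    positivity

lemma velocity_le {m : ℝ} (hm : 0 < m) {ξ : ℝ} (hξ : ξ ≠ 0) :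
    velocity m ξ ≤ 2 * Real.pi := by
  rw [← abs_of_pos (velocity_pos hm hξ), velocity, abs_div,
    div_le_iff₀ (hm.trans (lt_abs_dispersion m hξ)), abs_dispersion m hξ]
  have : |2 * Real.pi * ξ| ≤ √((2 * Real.pi * ξ) ^ 2 + m ^ 2) :=
    Real.abs_le_sqrt (by nlinarith)
  calc |4 * Real.pi ^ 2 * ξ| = 2 * Real.pi * |2 * Real.pi * ξ| := by
        rw [← abs_of_pos (by positivity : 0 < 2 * Real.pi), ← abs_mul,
          abs_of_pos (by positivity : 0 < 2 * Real.pi)]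
        ring_nf
    _ ≤ _ := by gcongr

lemma inv_velocity_le {m ρ : ℝ} (hm : 0 < m) (hρ : 0 < ρ) {ξ : ℝ} (hξ : ρ < |ξ|) :
    (velocity m ξ)⁻¹ ≤ 1 + m / ρ := by
  have hξ0 : ξ ≠ 0 := abs_pos.1 (hρ.trans hξ)
  have hpi : 3 < Real.pi := Real.pi_gt_three
  have hd : |dispersion m ξ| ≤ 2 * Real.pi * |ξ| + m := by
    rw [abs_dispersion m hξ0]
    apply Real.sqrt_le_iff.2 ⟨by positivity, ?_⟩
    rw [mul_pow, ← sq_abs ξ]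
    nlinarith [mul_pos (mul_pos Real.pi_pos (hρ.trans hξ)) hm]
  have hξp : 0 < |ξ| := abs_pos.2 hξ0
  rw [← abs_of_pos (inv_pos.2 (velocity_pos hm hξ0)), velocity, inv_div, abs_div,
    abs_mul, abs_of_pos (by positivity : 0 < 4 * Real.pi ^ 2), div_le_iff₀ (by positivity)]
  refine hd.trans ?_
  have h1 : m ≤ m / ρ * |ξ| := by
    rw [div_mul_eq_mul_div, le_div_iff₀ hρ]
    nlinarith
  have h2 : 0 < m / ρ * |ξ| := by positivity
  have h3 : 2 * Real.pi * |ξ| ≤ 4 * Real.pi ^ 2 * |ξ| :=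
    mul_le_mul_of_nonneg_right (by nlinarith) hξp.le
  nlinarith [mul_le_mul_of_nonneg_right (by nlinarith : 1 ≤ 4 * Real.pi ^ 2) h2.le]

/-- The oscillating factor `e^{-itΩ(ξ)}` with `Ω` the dispersion relation. -/
def phase (m t ξ : ℝ) : ℂ := Complex.exp (-Complex.I * t * dispersion m ξ)

/-- The algebra of functions generated by the constants, the phases, the derivatives of `h` along
the dispersion relation, the reciprocal dispersion relation, the velocity and its reciprocal. -/
inductive IsSymbol (m : ℝ) (h : ℝ → ℝ) : (ℝ → ℂ) → Prop
  | const (c : ℂ) : IsSymbol m h fun _ => c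
  | inv : IsSymbol m h fun ξ => ((dispersion m ξ)⁻¹ : ℝ)
  | vel : IsSymbol m h fun ξ => (velocity m ξ : ℝ)
  | slow : IsSymbol m h fun ξ => ((velocity m ξ)⁻¹ : ℝ)
  | cutoff (n : ℕ) : IsSymbol m h fun ξ => (iteratedDeriv n h (dispersion m ξ) : ℝ)
  | phase (t : ℝ) : IsSymbol m h (phase m t)
  | add {a b : ℝ → ℂ} : IsSymbol m h a → IsSymbol m h b → IsSymbol m h fun ξ => a ξ + b ξ
  | mul {a b : ℝ → ℂ} : IsSymbol m h a → IsSymbol m h b → IsSymbol m h fun ξ => a ξ * b ξ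

lemma norm_phase (m t ξ : ℝ) : ‖phase m t ξ‖ = 1 := by
  rw [phase, show -Complex.I * t * dispersion m ξ = ((-t * dispersion m ξ : ℝ) : ℂ) * Complex.I by
    push_cast; ring]
  exact Complex.norm_exp_ofReal_mul_I _

lemma phase_neg (m t ξ : ℝ) : phase m t (-ξ) = phase m (-t) ξ := by
  simp [phase, dispersion_neg]

lemma hasDerivAt_phase {m : ℝ} (hm : 0 < m) (t : ℝ) {ξ : ℝ} (hξ : ξ ≠ 0) :
    HasDerivAt (phase m t) (-Complex.I * t * velocity m ξ * phase m t ξ) ξ := by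
  have h := (((hasDerivAt_dispersion hm hξ).ofReal_comp).const_mul (-Complex.I * t)).cexp
  refine h.congr_deriv ?_
  rw [phase]
  ring

lemma hasDerivAt_velocity {m : ℝ} (hm : 0 < m) {ξ : ℝ} (hξ : ξ ≠ 0) :
    HasDerivAt (velocity m)
      ((dispersion m ξ)⁻¹ * (4 * Real.pi ^ 2 - velocity m ξ ^ 2)) ξ := by
  have hd := dispersion_ne_zero hm hξ
  have h := ((hasDerivAt_id ξ).const_mul (4 * Real.pi ^ 2)).div (hasDerivAt_dispersion hm hξ) hd
  refine h.congr_deriv ?_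
  simp only [velocity, id]
  field_simp

lemma IsSymbol.exists_bound {m ρ : ℝ} (hm : 0 < m) (hρ : 0 < ρ) {h : ℝ → ℝ}
    (hb : ∀ n, ∃ C, ∀ x, |iteratedDeriv n h x| ≤ C) {a : ℝ → ℂ} (ha : IsSymbol m h a) :
    ∃ C, ∀ ξ, ρ < |ξ| → ‖a ξ‖ ≤ C := by
  have ne {ξ : ℝ} (hξ : ρ < |ξ|) : ξ ≠ 0 := abs_pos.1 (hρ.trans hξ)
  induction ha with
  | const c => exact ⟨‖c‖, fun _ _ => le_rfl⟩
  | inv =>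
    refine ⟨m⁻¹, fun ξ hξ => ?_⟩
    rw [Complex.norm_real, Real.norm_eq_abs, abs_inv]
    gcongr
    exact (lt_abs_dispersion m (ne hξ)).le
  | vel =>
    refine ⟨2 * Real.pi, fun ξ hξ => ?_⟩
    rw [Complex.norm_real, Real.norm_eq_abs, abs_of_pos (velocity_pos hm (ne hξ))]
    exact velocity_le hm (ne hξ)
  | slow =>
    refine ⟨1 + m / ρ, fun ξ hξ => ?_⟩
    rw [Complex.norm_real, Real.norm_eq_abs, abs_of_pos (inv_pos.2 (velocity_pos hm (ne hξ)))]
    exact inv_velocity_le hm hρ hξ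
  | cutoff n =>
    obtain ⟨C, hC⟩ := hb n
    exact ⟨C, fun ξ _ => by simpa using hC (dispersion m ξ)⟩
  | phase t => exact ⟨1, fun ξ _ => (norm_phase m t ξ).le⟩
  | add _ _ iha ihb =>
    obtain ⟨A, hA⟩ := iha
    obtain ⟨B, hB⟩ := ihb
    exact ⟨A + B, fun ξ hξ => norm_add_le_of_le (hA ξ hξ) (hB ξ hξ)⟩
  | mul _ _ iha ihb =>
    obtain ⟨A, hA⟩ := iha
    obtain ⟨B, hB⟩ := ihb
    exact ⟨A * B, fun ξ hξ => norm_mul_le_of_le (hA ξ hξ) (hB ξ hξ)⟩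

lemma IsSymbol.exists_hasDerivAt {m : ℝ} (hm : 0 < m) {h : ℝ → ℝ} (hh : ContDiff ℝ (⊤ : ℕ∞) h)
    {a : ℝ → ℂ} (ha : IsSymbol m h a) :
    ∃ a', IsSymbol m h a' ∧ ∀ ξ, ξ ≠ 0 → HasDerivAt a (a' ξ) ξ := by
  have hvel : IsSymbol m h fun ξ => ((dispersion m ξ)⁻¹ : ℝ) *
      (4 * Real.pi ^ 2 + (-1) * (velocity m ξ * velocity m ξ)) :=
    .mul .inv (.add (.const _) (.mul (.const _) (.mul .vel .vel)))
  induction ha with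
  | const c => exact ⟨_, .const 0, fun ξ _ => hasDerivAt_const ξ c⟩
  | inv =>
    refine ⟨_, .mul (.const (-1)) (.mul .vel (.mul .inv .inv)), fun ξ hξ => ?_⟩
    refine ((hasDerivAt_dispersion hm hξ).inv (dispersion_ne_zero hm hξ)).ofReal_comp.congr_deriv ?_
    push_cast
    ring
  | vel =>
    refine ⟨_, hvel, fun ξ hξ => (hasDerivAt_velocity hm hξ).ofReal_comp.congr_deriv ?_⟩
    push_cast
    ring
  | slow =>
    refine ⟨_, .mul (.const (-1)) (.mul hvel (.mul .slow .slow)), fun ξ hξ => ?_⟩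
    refine ((hasDerivAt_velocity hm hξ).inv (velocity_pos hm hξ).ne').ofReal_comp.congr_deriv ?_
    push_cast
    ring
  | cutoff n =>
    refine ⟨_, .mul (.cutoff (n + 1)) .vel, fun ξ hξ => ?_⟩
    have hd : HasDerivAt (iteratedDeriv n h) (iteratedDeriv (n + 1) h (dispersion m ξ))
        (dispersion m ξ) := by
      rw [iteratedDeriv_succ]
      exact (hh.differentiable_iteratedDeriv n (mod_cast ENat.natCast_lt_top n)
        (dispersion m ξ)).hasDerivAt
    refine (hd.comp ξ (hasDerivAt_dispersion hm hξ)).ofReal_comp.congr_deriv ?_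
    push_cast
    ring
  | phase t =>
    exact ⟨_, .mul (.mul (.const _) .vel) (.phase t), fun ξ hξ => hasDerivAt_phase hm t hξ⟩
  | add _ _ iha ihb =>
    obtain ⟨a', ha', hda⟩ := iha
    obtain ⟨b', hb', hdb⟩ := ihb
    exact ⟨_, .add ha' hb', fun ξ hξ => (hda ξ hξ).add (hdb ξ hξ)⟩
  | mul ha hb iha ihb =>
    obtain ⟨a', ha', hda⟩ := iha
    obtain ⟨b', hb', hdb⟩ := ihb
    exact ⟨_, .add (.mul ha' hb) (.mul ha hb'), fun ξ hξ => (hda ξ hξ).mul (hdb ξ hξ)⟩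

/-- A symbol cut off to vanish near the spectral edges, i.e. for frequencies `|ξ| < r`. -/
structure IsCutSymbol (m : ℝ) (h : ℝ → ℝ) (r : ℝ) (a : ℝ → ℂ) : Prop where
  eq_symbol : ∃ b, IsSymbol m h b ∧ ∀ ξ, ξ ≠ 0 → r / 2 < |ξ| → a ξ = b ξ
  eq_zero : ∀ ξ, |ξ| < r → a ξ = 0

namespace IsCutSymbol

variable {m : ℝ} {h : ℝ → ℝ} {r : ℝ} {a : ℝ → ℂ}

lemma mul (ha : IsCutSymbol m h r a) {c : ℝ → ℂ} (hc : IsSymbol m h c) :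
    IsCutSymbol m h r fun ξ => c ξ * a ξ := by
  obtain ⟨b, hb, hab⟩ := ha.eq_symbol
  exact ⟨⟨_, .mul hc hb, fun ξ h0 hξ => by rw [hab ξ h0 hξ]⟩,
    fun ξ hξ => by rw [ha.eq_zero ξ hξ, mul_zero]⟩

lemma hasDerivAt_zero (ha : IsCutSymbol m h r a) {ξ : ℝ} (hξ : |ξ| < r) : HasDerivAt a 0 ξ := by
  have h0 : a =ᶠ[nhds ξ] fun _ => 0 := by
    filter_upwards [(isOpen_lt continuous_abs continuous_const).mem_nhds hξ] with x hx
    exact ha.eq_zero x hx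
  exact (hasDerivAt_const ξ (0 : ℂ)).congr_of_eventuallyEq h0

lemma differentiable_and_deriv (hm : 0 < m) (hh : ContDiff ℝ (⊤ : ℕ∞) h) (hr : 0 < r)
    (ha : IsCutSymbol m h r a) : Differentiable ℝ a ∧ IsCutSymbol m h r (deriv a) := by
  obtain ⟨b, hb, hab⟩ := ha.eq_symbol
  obtain ⟨b', hb', hd⟩ := hb.exists_hasDerivAt hm hh
  have key (ξ : ℝ) (hξ : r / 2 < |ξ|) : HasDerivAt a (b' ξ) ξ := by
    have h0 : ξ ≠ 0 := abs_pos.1 ((half_pos hr).trans hξ)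
    refine (hd ξ h0).congr_of_eventuallyEq ?_
    filter_upwards [(isOpen_lt continuous_const continuous_abs).mem_nhds hξ] with x hx
    exact hab x (abs_pos.1 ((half_pos hr).trans hx)) hx
  refine ⟨fun ξ => ?_, ⟨b', hb', fun ξ _ hξ => (key ξ hξ).deriv⟩,
    fun ξ hξ => (ha.hasDerivAt_zero hξ).deriv⟩
  rcases lt_or_ge (|ξ|) r with hξ | hξ
  · exact (ha.hasDerivAt_zero hξ).differentiableAt
  · exact (key ξ (by linarith)).differentiableAt

lemma exists_bound (hm : 0 < m) (hb : ∀ n, ∃ C, ∀ x, |iteratedDeriv n h x| ≤ C) (hr : 0 < r)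
    (ha : IsCutSymbol m h r a) : ∃ C, 0 ≤ C ∧ ∀ ξ, ‖a ξ‖ ≤ C := by
  obtain ⟨b, hbs, hab⟩ := ha.eq_symbol
  obtain ⟨C, hC⟩ := hbs.exists_bound hm (half_pos hr) hb
  refine ⟨max C 0, le_max_right _ _, fun ξ => ?_⟩
  rcases lt_or_ge (|ξ|) r with hξ | hξ
  · rw [ha.eq_zero ξ hξ, norm_zero]
    exact le_max_right _ _
  · have h2 : r / 2 < |ξ| := by linarith
    rw [hab ξ (abs_pos.1 ((half_pos hr).trans h2)) h2]
    exact (hC ξ h2).trans (le_max_left _ _)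

lemma hasTemperateGrowth (hm : 0 < m) (hh : ContDiff ℝ (⊤ : ℕ∞) h)
    (hb : ∀ n, ∃ C, ∀ x, |iteratedDeriv n h x| ≤ C) (hr : 0 < r)
    (ha : IsCutSymbol m h r a) : a.HasTemperateGrowth := by
  have key (n : ℕ) : ∀ a, IsCutSymbol m h r a →
      ContDiff ℝ n a ∧ ∃ C, ∀ x, ‖iteratedDeriv n a x‖ ≤ C := by
    induction n with
    | zero =>
      intro a ha
      obtain ⟨C, -, hC⟩ := ha.exists_bound hm hb hr
      exact ⟨contDiff_zero.2 (ha.differentiable_and_deriv hm hh hr).1.continuous, C,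
        by simpa using hC⟩
    | succ n ih =>
      intro a ha
      obtain ⟨hd, hda⟩ := ha.differentiable_and_deriv hm hh hr
      obtain ⟨hc, C, hC⟩ := ih _ hda
      refine ⟨?_, C, by simpa [iteratedDeriv_succ'] using hC⟩
      push_cast
      exact contDiff_succ_iff_deriv.2 ⟨hd, by simp, hc⟩
  refine ⟨contDiff_infty.2 fun n => (key n a ha).1, fun n => ?_⟩
  obtain ⟨-, C, hC⟩ := key n a ha
  exact ⟨0, C, fun x => by simpa [norm_iteratedFDeriv_eq_norm_iteratedDeriv] using hC x⟩

end IsCutSymbol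

/-- The Fourier multiplier with symbol `e^{-itΩ(ξ)} a(ξ)`, applied to the inverse Fourier transform
of `φ`. -/
def propagator (m t : ℝ) (a : ℝ → ℂ) (φ : 𝓢(ℝ, ℂ)) : 𝓢(ℝ, ℂ) :=
  𝓕⁻ (SchwartzMap.smulLeftCLM ℂ (fun ξ => phase m t ξ * a ξ) φ)

lemma eLpNorm_fourier_schwartz (φ : 𝓢(ℝ, ℂ)) :
    eLpNorm (𝓕 φ : 𝓢(ℝ, ℂ)) 2 volume = eLpNorm φ 2 volume := by
  have h := SchwartzMap.norm_fourier_toL2_eq φ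
  have h1 := SchwartzMap.norm_toLp (p := 2) (μ := volume) (f := φ)
  have h2 := SchwartzMap.norm_toLp (p := 2) (μ := volume) (f := 𝓕 φ)
  rw [h1, h2] at h
  exact (ENNReal.toReal_eq_toReal_iff' ((𝓕 φ).eLpNorm_lt_top 2 volume).ne
    (φ.eLpNorm_lt_top 2 volume).ne).1 h

lemma eLpNorm_fourierInv_schwartz (φ : 𝓢(ℝ, ℂ)) :
    eLpNorm (𝓕⁻ φ : 𝓢(ℝ, ℂ)) 2 volume = eLpNorm φ 2 volume := by
  rw [← eLpNorm_fourier_schwartz (𝓕⁻ φ), FourierTransform.fourier_fourierInv_eq]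

lemma fourierInv_derivCLM_apply (φ : 𝓢(ℝ, ℂ)) (x : ℝ) :
    (𝓕⁻ (SchwartzMap.derivCLM ℂ ℂ φ) : 𝓢(ℝ, ℂ)) x
      = -(2 * Real.pi * Complex.I * x) * (𝓕⁻ φ : 𝓢(ℝ, ℂ)) x := by
  have h1 : SchwartzMap.derivCLM ℂ ℂ φ = LineDeriv.lineDerivOp (1 : ℝ) φ := by
    ext x
    rw [SchwartzMap.lineDerivOp_apply_eq_fderiv, SchwartzMap.derivCLM_apply,
      fderiv_apply_one_eq_deriv]
  have h2 : (inner ℝ · (1 : ℝ) : ℝ → ℝ).HasTemperateGrowth := by fun_prop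
  rw [h1, SchwartzMap.fourierInv_lineDerivOp_eq]
  simp only [smul_apply, SchwartzMap.smulLeftCLM_apply_apply h2]
  simp
  ring

lemma derivCLM_fourier (φ : 𝓢(ℝ, ℂ)) :
    SchwartzMap.derivCLM ℂ ℂ (𝓕 φ : 𝓢(ℝ, ℂ)) =
      𝓕 (SchwartzMap.smulLeftCLM ℂ (fun x : ℝ => (-(2 * Real.pi * Complex.I) * x : ℂ)) φ) := by
  have h1 : SchwartzMap.derivCLM ℂ ℂ (𝓕 φ : 𝓢(ℝ, ℂ)) =
      LineDeriv.lineDerivOp (1 : ℝ) (𝓕 φ : 𝓢(ℝ, ℂ)) := by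
    ext x
    rw [SchwartzMap.lineDerivOp_apply_eq_fderiv, SchwartzMap.derivCLM_apply,
      fderiv_apply_one_eq_deriv]
  have h2 : (inner ℝ · (1 : ℝ) : ℝ → ℝ).HasTemperateGrowth := by fun_prop
  have h3 : (fun x : ℝ => (-(2 * Real.pi * Complex.I) * x : ℂ)).HasTemperateGrowth := by fun_prop
  rw [h1, SchwartzMap.lineDerivOp_fourier_eq]
  congr 1
  ext x
  simp only [smul_apply, SchwartzMap.smulLeftCLM_apply_apply h2,
    SchwartzMap.smulLeftCLM_apply_apply h3]
  simp
  ring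

section Decay

variable {m : ℝ} {h : ℝ → ℝ} {r : ℝ} {a : ℝ → ℂ}

lemma IsCutSymbol.propagator_apply_eq (hm : 0 < m) (hh : ContDiff ℝ (⊤ : ℕ∞) h)
    (hb : ∀ n, ∃ C, ∀ x, |iteratedDeriv n h x| ≤ C) (hr : 0 < r)
    (ha : IsCutSymbol m h r a) (t : ℝ) (φ : 𝓢(ℝ, ℂ)) (x : ℝ) :
    Complex.I * t * propagator m t a φ x =
      2 * Real.pi * Complex.I * x *
          propagator m t (fun ξ => ((velocity m ξ)⁻¹ : ℝ) * a ξ) φ x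
        + propagator m t (deriv fun ξ => ((velocity m ξ)⁻¹ : ℝ) * a ξ) φ x
        + propagator m t (fun ξ => ((velocity m ξ)⁻¹ : ℝ) * a ξ)
            (SchwartzMap.derivCLM ℂ ℂ φ) x := by
  have hcut := ha.mul .slow
  set b : ℝ → ℂ := fun ξ => ((velocity m ξ)⁻¹ : ℝ) * a ξ with hbdef
  obtain ⟨hbd, hcut'⟩ := hcut.differentiable_and_deriv hm hh hr
  have tg {c : ℝ → ℂ} (hc : IsCutSymbol m h r c) :
      (fun ξ => phase m t ξ * c ξ).HasTemperateGrowth :=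
    (hc.mul (.phase t)).hasTemperateGrowth hm hh hb hr
  have key : SchwartzMap.derivCLM ℂ ℂ
        (SchwartzMap.smulLeftCLM ℂ (fun ξ => phase m t ξ * b ξ) φ) =
      (-(Complex.I * t)) • SchwartzMap.smulLeftCLM ℂ (fun ξ => phase m t ξ * a ξ) φ
        + SchwartzMap.smulLeftCLM ℂ (fun ξ => phase m t ξ * deriv b ξ) φ
        + SchwartzMap.smulLeftCLM ℂ (fun ξ => phase m t ξ * b ξ)
            (SchwartzMap.derivCLM ℂ ℂ φ) := by
    ext ξ
    have hφ : HasDerivAt φ (deriv φ ξ) ξ := φ.hasDerivAt ξ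
    have hpb : HasDerivAt (fun ξ => phase m t ξ * b ξ)
        (-(Complex.I * t) * (phase m t ξ * a ξ) + phase m t ξ * deriv b ξ) ξ := by
      rcases lt_or_ge (|ξ|) r with hξ | hξ
      · refine ((hcut.mul (.phase t)).hasDerivAt_zero hξ).congr_deriv ?_
        simp [ha.eq_zero ξ hξ, hcut'.eq_zero ξ hξ]
      · have h0 : ξ ≠ 0 := abs_pos.1 (hr.trans_le hξ)
        refine ((hasDerivAt_phase hm t h0).mul (hbd ξ).hasDerivAt).congr_deriv ?_
        have hv : (velocity m ξ : ℂ) ≠ 0 := mod_cast (velocity_pos hm h0).ne'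
        simp only [hbdef, Complex.ofReal_inv]
        field_simp
    rw [SchwartzMap.derivCLM_apply, SchwartzMap.smulLeftCLM_apply (tg hcut)]
    simp only [add_apply, smul_apply,
      SchwartzMap.smulLeftCLM_apply_apply (tg hcut), SchwartzMap.smulLeftCLM_apply_apply (tg ha),
      SchwartzMap.smulLeftCLM_apply_apply (tg hcut'), SchwartzMap.derivCLM_apply, smul_eq_mul]
    rw [(hpb.fun_mul hφ).deriv]
    ring
  have h1 := fourierInv_derivCLM_apply
    (SchwartzMap.smulLeftCLM ℂ (fun ξ => phase m t ξ * b ξ) φ) x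
  rw [key, FourierTransform.fourierInv_add, FourierTransform.fourierInv_add,
    FourierTransform.fourierInv_smul] at h1
  simp only [add_apply, smul_apply, smul_eq_mul] at h1
  simp only [propagator]
  linear_combination -h1

/-- The decaying weight `(1 + x²)^{-1/2}`. -/
def weight (x : ℝ) : ℝ := (√(1 + x ^ 2))⁻¹

lemma weight_nonneg (x : ℝ) : 0 ≤ weight x := by unfold weight; positivity

lemma weight_le_one (x : ℝ) : weight x ≤ 1 :=
  inv_le_one_of_one_le₀ (Real.one_le_sqrt.2 (by nlinarith [sq_nonneg x]))

lemma abs_mul_weight_le_one (x : ℝ) : |x| * weight x ≤ 1 := by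
  rw [weight, ← div_eq_mul_inv, div_le_one (by positivity)]
  exact Real.abs_le_sqrt (by linarith)

lemma continuous_weight : Continuous weight := by
  unfold weight
  exact Continuous.inv₀ (by fun_prop) fun x => by positivity

lemma weight_sq (x : ℝ) : weight x ^ 2 = (1 + x ^ 2)⁻¹ := by
  rw [weight, inv_pow, Real.sq_sqrt (by positivity)]

/-- Integrating by parts `n` times in frequency trades `n` powers of `t` for `n` powers of the
weight and `n` derivatives of `φ`. -/
lemma IsCutSymbol.eLpNorm_propagator_le (hm : 0 < m) (hh : ContDiff ℝ (⊤ : ℕ∞) h)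
    (hb : ∀ n, ∃ C, ∀ x, |iteratedDeriv n h x| ≤ C) (hr : 0 < r) (n : ℕ) :
    ∀ a, IsCutSymbol m h r a → ∃ C : ℝ≥0, ∀ t (φ : 𝓢(ℝ, ℂ)),
      ‖t‖ₑ ^ n * eLpNorm (fun x => weight x ^ n • propagator m t a φ x) 2 volume ≤
        C * ∑ l ∈ Finset.range (n + 1), eLpNorm ((SchwartzMap.derivCLM ℂ ℂ)^[l] φ) 2 volume := by
  induction n with
  | zero =>
    intro a ha
    obtain ⟨C, hC0, hC⟩ := ha.exists_bound hm hb hr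
    lift C to ℝ≥0 using hC0
    refine ⟨C, fun t φ => ?_⟩
    have htg := (ha.mul (.phase t)).hasTemperateGrowth hm hh hb hr
    simp only [pow_zero, one_mul, one_smul, zero_add, Finset.range_one, Finset.sum_singleton,
      Function.iterate_zero, id]
    have h1 : eLpNorm (propagator m t a φ) 2 volume ≤ _ :=
      (eLpNorm_fourierInv_schwartz _).trans_le
        (eLpNorm_le_nnreal_smul_eLpNorm_of_ae_le_mul (g := φ) (c := C)
          (Filter.Eventually.of_forall fun ξ => ?_) 2)
    · simpa [ENNReal.smul_def] using h1
    · rw [SchwartzMap.smulLeftCLM_apply_apply htg, smul_eq_mul]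
      apply NNReal.coe_le_coe.1
      simp only [coe_nnnorm, NNReal.coe_mul, norm_mul, norm_phase, one_mul]
      exact mul_le_mul_of_nonneg_right (hC ξ) (norm_nonneg _)
  | succ n ih =>
    intro a ha
    have hcut := ha.mul .slow
    obtain ⟨C₁, h₁⟩ := ih _ hcut
    obtain ⟨C₂, h₂⟩ := ih _ (hcut.differentiable_and_deriv hm hh hr).2
    refine ⟨2 * NNReal.pi * C₁ + C₂ + C₁, fun t φ => ?_⟩
    set b : ℝ → ℂ := fun ξ => ((velocity m ξ)⁻¹ : ℝ) * a ξ
    set S := ∑ l ∈ Finset.range (n + 1 + 1), eLpNorm ((SchwartzMap.derivCLM ℂ ℂ)^[l] φ) 2 volume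
      with hS
    have hS₁ : ∑ l ∈ Finset.range (n + 1), eLpNorm ((SchwartzMap.derivCLM ℂ ℂ)^[l] φ) 2 volume
        ≤ S := Finset.sum_le_sum_of_subset (by simp)
    have hS₂ : ∑ l ∈ Finset.range (n + 1), eLpNorm ((SchwartzMap.derivCLM ℂ ℂ)^[l]
        (SchwartzMap.derivCLM ℂ ℂ φ)) 2 volume ≤ S := by
      have := Finset.sum_range_succ'
        (fun l => eLpNorm ((SchwartzMap.derivCLM ℂ ℂ)^[l] φ) 2 volume) (n + 1)
      rw [hS, this]
      simp only [Function.iterate_succ_apply]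
      exact le_self_add
    have cont (k : ℕ) (u : 𝓢(ℝ, ℂ)) :
        AEStronglyMeasurable (fun x => weight x ^ k • u x) volume :=
      ((continuous_weight.pow k).smul u.continuous).aestronglyMeasurable
    have cont' : AEStronglyMeasurable (fun x : ℝ => weight x ^ (n + 1) •
        ((2 * Real.pi * Complex.I * x : ℂ) * propagator m t b φ x)) volume := by
      apply Continuous.aestronglyMeasurable
      have := (propagator m t b φ).continuous
      have := continuous_weight
      fun_prop
    have wle (u : 𝓢(ℝ, ℂ)) : eLpNorm (fun x => weight x ^ (n + 1) • u x) 2 volume ≤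
        eLpNorm (fun x => weight x ^ n • u x) 2 volume := by
      refine eLpNorm_mono fun x => ?_
      rw [norm_smul, norm_smul, norm_pow, norm_pow, Real.norm_of_nonneg (weight_nonneg x)]
      gcongr ?_ * _
      exact pow_le_pow_of_le_one (weight_nonneg x) (weight_le_one x) n.le_succ
    have wle' : eLpNorm (fun x : ℝ => weight x ^ (n + 1) •
        ((2 * Real.pi * Complex.I * x : ℂ) * propagator m t b φ x)) 2 volume ≤
        (2 * NNReal.pi : ℝ≥0) *
          eLpNorm (fun x => weight x ^ n • propagator m t b φ x) 2 volume := by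
      refine (eLpNorm_le_nnreal_smul_eLpNorm_of_ae_le_mul (Filter.Eventually.of_forall
        fun x => ?_) 2).trans_eq (by rw [ENNReal.smul_def, smul_eq_mul])
      apply NNReal.coe_le_coe.1
      simp only [coe_nnnorm, NNReal.coe_mul, NNReal.coe_ofNat, NNReal.coe_real_pi, norm_smul, norm_mul, norm_pow,
        Real.norm_of_nonneg (weight_nonneg x), Complex.norm_I, Complex.norm_real,
        Complex.norm_ofNat, Real.norm_of_nonneg Real.pi_pos.le, mul_one, Real.norm_eq_abs]
      have := mul_le_mul_of_nonneg_left (abs_mul_weight_le_one x)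
        (by have := weight_nonneg x; positivity :
          0 ≤ 2 * Real.pi * (weight x ^ n * ‖propagator m t b φ x‖))
      rw [pow_succ]
      linarith
    have split : ‖t‖ₑ * eLpNorm (fun x => weight x ^ (n + 1) • propagator m t a φ x) 2 volume ≤
        (2 * NNReal.pi : ℝ≥0) *
          eLpNorm (fun x => weight x ^ n • propagator m t b φ x) 2 volume
        + eLpNorm (fun x => weight x ^ n • propagator m t (deriv b) φ x) 2 volume
        + eLpNorm (fun x => weight x ^ n •
            propagator m t b (SchwartzMap.derivCLM ℂ ℂ φ) x) 2 volume := by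
      have hI : ‖t‖ₑ = ‖Complex.I * t‖ₑ := by
        rw [enorm_mul, ← ofReal_norm Complex.I, Complex.norm_I, ENNReal.ofReal_one, one_mul,
          ← ofReal_norm, ← ofReal_norm, Complex.norm_real]
      rw [hI, ← eLpNorm_const_smul]
      have heq : ((Complex.I * t) • fun x => weight x ^ (n + 1) • propagator m t a φ x) =
          ((fun x : ℝ => weight x ^ (n + 1) •
              ((2 * Real.pi * Complex.I * x : ℂ) * propagator m t b φ x))
            + fun x => weight x ^ (n + 1) • propagator m t (deriv b) φ x)
            + fun x => weight x ^ (n + 1) •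
                propagator m t b (SchwartzMap.derivCLM ℂ ℂ φ) x := by
        funext x
        simp only [Pi.smul_apply, Pi.add_apply, ← smul_add]
        rw [smul_comm, smul_eq_mul, ha.propagator_apply_eq hm hh hb hr]
      rw [heq]
      refine (eLpNorm_add_le (cont'.add (cont _ _)) (cont _ _) one_le_two).trans ?_
      refine add_le_add ((eLpNorm_add_le cont' (cont _ _) one_le_two).trans ?_) (wle _)
      exact add_le_add wle' (wle _)
    calc _ = ‖t‖ₑ ^ n * (‖t‖ₑ *
          eLpNorm (fun x => weight x ^ (n + 1) • propagator m t a φ x) 2 volume) := by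
          rw [pow_succ, mul_assoc]
      _ ≤ _ := mul_le_mul_right split _
      _ = (2 * NNReal.pi : ℝ≥0) * (‖t‖ₑ ^ n *
            eLpNorm (fun x => weight x ^ n • propagator m t b φ x) 2 volume)
          + ‖t‖ₑ ^ n * eLpNorm (fun x => weight x ^ n • propagator m t (deriv b) φ x) 2 volume
          + ‖t‖ₑ ^ n * eLpNorm (fun x => weight x ^ n •
              propagator m t b (SchwartzMap.derivCLM ℂ ℂ φ) x) 2 volume := by ring
      _ ≤ (2 * NNReal.pi : ℝ≥0) * (C₁ * S) + C₂ * S + C₁ * S := by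
          refine add_le_add (add_le_add (mul_le_mul_right ?_ _) ?_) ?_
          · exact (h₁ t φ).trans (mul_le_mul_right hS₁ _)
          · exact (h₂ t φ).trans (mul_le_mul_right hS₁ _)
          · exact (h₁ t _).trans (mul_le_mul_right hS₂ _)
      _ = _ := by push_cast; ring

end Decay

lemma iterate_derivCLM_fourier (l : ℕ) (u : 𝓢(ℝ, ℂ)) :
    (SchwartzMap.derivCLM ℂ ℂ)^[l] (𝓕 u : 𝓢(ℝ, ℂ)) =
      𝓕 ((SchwartzMap.smulLeftCLM ℂ
        (fun x : ℝ => (-(2 * Real.pi * Complex.I) * x : ℂ)))^[l] u) := by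
  induction l generalizing u with
  | zero => rfl
  | succ l ih => rw [Function.iterate_succ_apply, derivCLM_fourier, ih, Function.iterate_succ_apply]

lemma eLpNorm_iterate_derivCLM_fourier_le {l : ℕ} (hl : l ≤ 2) (u : 𝓢(ℝ, ℂ)) :
    eLpNorm ((SchwartzMap.derivCLM ℂ ℂ)^[l] (𝓕 u : 𝓢(ℝ, ℂ))) 2 volume ≤
      ((2 * NNReal.pi) ^ 2 : ℝ≥0) * eLpNorm (fun x => (1 + x ^ 2) • u x) 2 volume := by
  have h3 : (fun x : ℝ => (-(2 * Real.pi * Complex.I) * x : ℂ)).HasTemperateGrowth := by fun_prop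
  have hnorm (x : ℝ) : ‖((SchwartzMap.smulLeftCLM ℂ
      (fun x : ℝ => (-(2 * Real.pi * Complex.I) * x : ℂ)))^[l] u) x‖
      = (2 * Real.pi * |x|) ^ l * ‖u x‖ := by
    induction l generalizing u with
    | zero => simp
    | succ l ih =>
      rw [Function.iterate_succ_apply, ih (by omega), SchwartzMap.smulLeftCLM_apply_apply h3,
        norm_smul]
      simp [abs_of_pos Real.pi_pos]
      ring
  rw [iterate_derivCLM_fourier, eLpNorm_fourier_schwartz]
  refine (eLpNorm_le_nnreal_smul_eLpNorm_of_ae_le_mul (c := (2 * NNReal.pi) ^ 2)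
    (g := fun x => (1 + x ^ 2) • u x) (Filter.Eventually.of_forall fun x => ?_) 2).trans_eq
    (by rw [ENNReal.smul_def, smul_eq_mul])
  apply NNReal.coe_le_coe.1
  rw [coe_nnnorm, hnorm, NNReal.coe_mul, coe_nnnorm, norm_smul,
    Real.norm_of_nonneg (by positivity : 0 ≤ 1 + x ^ 2), ← mul_assoc]
  refine mul_le_mul_of_nonneg_right ?_ (norm_nonneg _)
  simp only [NNReal.coe_pow, NNReal.coe_mul, NNReal.coe_ofNat, NNReal.coe_real_pi]
  have hpi : 1 ≤ 2 * Real.pi := by linarith [Real.pi_gt_three]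
  rw [mul_pow]
  refine mul_le_mul (pow_le_pow_right₀ hpi hl) ?_ (by positivity) (by positivity)
  interval_cases l
  · nlinarith
  · nlinarith [sq_nonneg (|x| - 1), sq_abs x]
  · rw [sq_abs]; linarith

/-- The propagator with a symbol vanishing at low frequencies decays like `t⁻²` between spaces
with weight exponent `2`. -/
lemma IsCutSymbol.eLpNorm_propagator_fourier_le {m r : ℝ} {h : ℝ → ℝ} {a : ℝ → ℂ} (hm : 0 < m)
    (hh : ContDiff ℝ (⊤ : ℕ∞) h) (hb : ∀ n, ∃ C, ∀ x, |iteratedDeriv n h x| ≤ C) (hr : 0 < r)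
    (ha : IsCutSymbol m h r a) : ∃ C : ℝ≥0, ∀ t (u : 𝓢(ℝ, ℂ)),
      (1 + ‖t‖ₑ ^ 2) * eLpNorm (fun x => weight x ^ 2 • propagator m t a (𝓕 u) x) 2 volume ≤
        C * eLpNorm (fun x => (1 + x ^ 2) • u x) 2 volume := by
  obtain ⟨C₀, h₀⟩ := ha.eLpNorm_propagator_le hm hh hb hr 0
  obtain ⟨C₂, h₂⟩ := ha.eLpNorm_propagator_le hm hh hb hr 2
  refine ⟨C₀ * (2 * NNReal.pi) ^ 2 + C₂ * (3 * (2 * NNReal.pi) ^ 2), fun t u => ?_⟩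
  rw [add_mul, one_mul, ENNReal.coe_add, add_mul]
  refine add_le_add ?_ ?_
  · calc eLpNorm (fun x => weight x ^ 2 • propagator m t a (𝓕 u) x) 2 volume
        ≤ eLpNorm (fun x => weight x ^ 0 • propagator m t a (𝓕 u) x) 2 volume := by
          refine eLpNorm_mono fun x => ?_
          rw [norm_smul, norm_smul, norm_pow, norm_pow, Real.norm_of_nonneg (weight_nonneg x)]
          gcongr ?_ * _
          exact pow_le_pow_of_le_one (weight_nonneg x) (weight_le_one x) (Nat.zero_le 2)
      _ = ‖t‖ₑ ^ 0 * eLpNorm (fun x => weight x ^ 0 • propagator m t a (𝓕 u) x) 2 volume := by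
          rw [pow_zero, one_mul]
      _ ≤ _ := h₀ t (𝓕 u)
      _ ≤ _ := by
          rw [Finset.sum_range_one, ENNReal.coe_mul, mul_assoc]
          exact mul_le_mul_right (eLpNorm_iterate_derivCLM_fourier_le (Nat.zero_le 2) u) _
  · refine (h₂ t (𝓕 u)).trans ?_
    rw [ENNReal.coe_mul, mul_assoc]
    refine mul_le_mul_right ((Finset.sum_le_card_nsmul _ _ _ fun l hl =>
      eLpNorm_iterate_derivCLM_fourier_le (by simp at hl; omega) u).trans_eq ?_) _
    simp [mul_assoc]

lemma exists_bound_iteratedDeriv {h : ℝ → ℝ} (hh : ContDiff ℝ (⊤ : ℕ∞) h) {R c : ℝ}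
    (hc : ∀ ω, R ≤ |ω| → h ω = c) (n : ℕ) : ∃ C, ∀ x, |iteratedDeriv n h x| ≤ C := by
  have hcont : Continuous (iteratedDeriv n h) :=
    hh.continuous_iteratedDeriv n (mod_cast le_top)
  obtain ⟨C, hC⟩ := (isCompact_Icc (a := -R) (b := R)).exists_bound_of_continuousOn
    hcont.continuousOn
  refine ⟨max C |c|, fun x => ?_⟩
  rcases le_or_gt (|x|) R with hx | hx
  · exact (hC x (abs_le.1 hx)).trans (le_max_left _ _)
  · have h0 : h =ᶠ[nhds x] fun _ => c := by
      filter_upwards [(isOpen_lt continuous_const continuous_abs).mem_nhds hx] with y hy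
      exact hc y (le_of_lt hy)
    rw [h0.iteratedDeriv_eq, iteratedDeriv_const]
    split_ifs
    · exact le_max_right _ _
    · simp

lemma abs_dispersion_le {m : ℝ} (hm : 0 < m) {ε ξ : ℝ} (hε : 0 < ε)
    (hξ : |ξ| < ε / (2 * Real.pi)) : |dispersion m ξ| ≤ m + ε := by
  rcases eq_or_ne ξ 0 with rfl | h0
  · rw [dispersion_zero, abs_zero]
    positivity
  · rw [lt_div_iff₀ (by positivity)] at hξ
    rw [abs_dispersion m h0]
    apply Real.sqrt_le_iff.2 ⟨by positivity, ?_⟩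
    have h1 : (2 * Real.pi * ξ) ^ 2 = (|ξ| * (2 * Real.pi)) ^ 2 := by
      rw [mul_pow, mul_pow |ξ|, sq_abs]
      ring
    have h2 : (|ξ| * (2 * Real.pi)) ^ 2 ≤ ε ^ 2 := by gcongr
    nlinarith [mul_pos hm hε]

lemma isCutSymbol_cutoff_mul {m ε : ℝ} (hm : 0 < m) (hε : 0 < ε) {h : ℝ → ℝ}
    (hlow : ∀ ω, |ω| ≤ m + ε → h ω = 0) {b : ℝ → ℂ} (hb : IsSymbol m h b) :
    IsCutSymbol m h (ε / (2 * Real.pi)) fun ξ => (h (dispersion m ξ) : ℂ) * b ξ where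
  eq_symbol := ⟨_, (IsSymbol.cutoff 0).mul hb, fun ξ _ _ => by rw [iteratedDeriv_zero]⟩
  eq_zero ξ hξ := by rw [hlow _ (abs_dispersion_le hm hε hξ), Complex.ofReal_zero, zero_mul]

/-- The entries of `(1 + s (mβ / Ω(ξ) - α Ω'(ξ) / 2π)) / 2`; for `s = 1` and `s = -1` these are
the symbols of the spectral projections of the free Dirac operator. -/
def projSymbol (m s : ℝ) (i j : Fin 2) (ξ : ℝ) : ℂ :=
  1 / 2 * ((1 : Matrix (Fin 2) (Fin 2) ℂ) i j
    + s * (m * Mβ i j * ((dispersion m ξ)⁻¹ : ℝ) - Mα i j / (2 * Real.pi) * (velocity m ξ : ℝ)))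

lemma isSymbol_projSymbol (m s : ℝ) (h : ℝ → ℝ) (i j : Fin 2) :
    IsSymbol m h (projSymbol m s i j) := by
  have : IsSymbol m h fun ξ => 1 / 2 * ((1 : Matrix (Fin 2) (Fin 2) ℂ) i j
    + s * (m * Mβ i j * ((dispersion m ξ)⁻¹ : ℝ)
      + -(Mα i j / (2 * Real.pi)) * (velocity m ξ : ℝ))) :=
    .mul (.const _) (.add (.const _) (.mul (.const _)
      (.add (.mul (.const _) .inv) (.mul (.const _) .vel))))
  convert this using 2
  rw [projSymbol]
  ring

/-- The `j`-th component of a vector-valued Schwartz function. -/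
def component (j : Fin 2) (f : 𝓢(ℝ, Fin 2 → ℂ)) : 𝓢(ℝ, ℂ) :=
  SchwartzMap.postcompCLM (ContinuousLinearMap.proj (R := ℂ) (φ := fun _ : Fin 2 => ℂ) j) f

lemma fourier_schwartz_apply (u : 𝓢(ℝ, ℂ)) (ξ : ℝ) :
    (𝓕 u : 𝓢(ℝ, ℂ)) ξ = ∫ y : ℝ, Complex.exp (-(2 * Real.pi * ξ * y * Complex.I)) * u y := by
  rw [SchwartzMap.fourier_coe, Real.fourier_eq']
  refine integral_congr_ae (.of_forall fun y => ?_)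
  simp only [smul_eq_mul]
  congr 2
  simp
  ring

lemma integrable_exp_mul (u : 𝓢(ℝ, ℂ)) (c : ℝ) :
    Integrable fun y : ℝ => Complex.exp (c * y * Complex.I) * u y := by
  refine u.integrable.bdd_mul (c := 1) (by fun_prop) (.of_forall fun y => ?_)
  rw [← Complex.ofReal_mul, Complex.norm_exp_ofReal_mul_I]

lemma Dmat_apply_eq (m ω x y : ℝ) (i j : Fin 2) {k : ℝ}
    (hk : Real.sign ω * √(ω ^ 2 - m ^ 2) = k) :
    Dmat m ω (x - y) i j =
      Complex.exp (k * x * Complex.I) * (1 / 2 * (-Complex.I * Mα i j + Complex.I *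
          (m * Mβ i j + ω * (1 : Matrix (Fin 2) (Fin 2) ℂ) i j) / k)) *
        Complex.exp ((-k : ℝ) * y * Complex.I)
      + Complex.exp (-(k * x * Complex.I)) * (1 / 2 * (Complex.I * Mα i j + Complex.I *
          (m * Mβ i j + ω * (1 : Matrix (Fin 2) (Fin 2) ℂ) i j) / k)) *
        Complex.exp (k * y * Complex.I) := by
  have e1 : Complex.exp (k * x * Complex.I) * Complex.exp ((-k : ℝ) * y * Complex.I) =
      Complex.cos (k * (x - y)) + Complex.sin (k * (x - y)) * Complex.I := by
    rw [← Complex.exp_add, ← Complex.exp_mul_I]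
    congr 1
    push_cast
    ring
  have e2 : Complex.exp (-(k * x * Complex.I)) * Complex.exp (k * y * Complex.I) =
      Complex.cos (k * (x - y)) - Complex.sin (k * (x - y)) * Complex.I := by
    rw [← Complex.exp_add, show -(k * x * Complex.I) + k * y * Complex.I =
      (-(k * (x - y) : ℂ)) * Complex.I by ring, Complex.exp_mul_I, Complex.cos_neg,
      Complex.sin_neg]
    ring
  rw [mul_right_comm, e1, mul_right_comm, e2, Dmat, hk]
  simp only [Matrix.add_apply, Matrix.smul_apply, smul_eq_mul, Complex.ofReal_sin,
    Complex.ofReal_cos, Complex.ofReal_mul, Complex.ofReal_sub]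
  linear_combination (Complex.sin (k * (x - y)) * Mα i j) * Complex.I_sq

lemma integral_Dmat_mulVec_apply (m ω x : ℝ) (f : 𝓢(ℝ, Fin 2 → ℂ)) (i : Fin 2) {ξ : ℝ}
    (hk : Real.sign ω * √(ω ^ 2 - m ^ 2) = 2 * Real.pi * ξ) :
    (∫ y : ℝ, (Dmat m ω (x - y)).mulVec (f y)) i =
      ∑ j, (Complex.exp ((2 * Real.pi * ξ : ℝ) * x * Complex.I) *
            (1 / 2 * (-Complex.I * Mα i j + Complex.I *
              (m * Mβ i j + ω * (1 : Matrix (Fin 2) (Fin 2) ℂ) i j) / (2 * Real.pi * ξ : ℝ))) *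
            𝓕 (component j f) ξ
        + Complex.exp (-((2 * Real.pi * ξ : ℝ) * x * Complex.I)) *
            (1 / 2 * (Complex.I * Mα i j + Complex.I *
              (m * Mβ i j + ω * (1 : Matrix (Fin 2) (Fin 2) ℂ) i j) / (2 * Real.pi * ξ : ℝ))) *
            𝓕 (component j f) (-ξ)) := by
  have hint (i : Fin 2) : ∀ j ∈ Finset.univ, Integrable fun y : ℝ =>
      (Dmat m ω (x - y) i j * component j f y) := fun j _ => by
    simp_rw [Dmat_apply_eq m ω x _ i j hk, add_mul, mul_assoc (_ * _)]
    exact ((integrable_exp_mul _ _).const_mul _).add ((integrable_exp_mul _ _).const_mul _)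
  have hexp (y : ℝ) (i : Fin 2) : (Dmat m ω (x - y)).mulVec (f y) i =
      ∑ j, Dmat m ω (x - y) i j * component j f y := rfl
  rw [eval_integral fun i => by simp_rw [hexp]; exact integrable_finsetSum _ (hint i)]
  simp_rw [hexp]
  rw [integral_finsetSum _ (hint i)]
  refine Finset.sum_congr rfl fun j _ => ?_
  simp_rw [Dmat_apply_eq m ω x _ i j hk, add_mul, mul_assoc (_ * _)]
  rw [integral_add ((integrable_exp_mul _ _).const_mul _) ((integrable_exp_mul _ _).const_mul _),
    integral_const_mul, integral_const_mul, fourier_schwartz_apply, fourier_schwartz_apply]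
  congr 3
  · funext y
    congr 2
    push_cast
    ring
  · funext y
    congr 2
    push_cast
    ring

/-- The oscillating factor `e^{2πiξx}`. -/
def wave (x ξ : ℝ) : ℂ := Complex.exp ((2 * Real.pi * ξ : ℝ) * x * Complex.I)

lemma norm_wave (x ξ : ℝ) : ‖wave x ξ‖ = 1 := by
  rw [wave, ← Complex.ofReal_mul, Complex.norm_exp_ofReal_mul_I]

lemma continuous_wave (x : ℝ) : Continuous (wave x) := by
  unfold wave
  fun_prop

lemma fourierInv_schwartz_apply (u : 𝓢(ℝ, ℂ)) (x : ℝ) :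
    (𝓕⁻ u : 𝓢(ℝ, ℂ)) x = ∫ ξ : ℝ, wave x ξ * u ξ := by
  rw [SchwartzMap.fourierInv_coe, Real.fourierInv_eq']
  refine integral_congr_ae (.of_forall fun ξ => ?_)
  simp only [smul_eq_mul, wave]
  congr 2
  simp
  ring

lemma integrable_wave_mul (u : 𝓢(ℝ, ℂ)) (x : ℝ) : Integrable fun ξ => wave x ξ * u ξ :=
  u.integrable.bdd_mul (c := 1) (continuous_wave x).aestronglyMeasurable
    (.of_forall fun ξ => (norm_wave x ξ).le)

/-- The contribution of the frequency `ξ` to the `i`-th component of the propagated function. -/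
def spectralDensity (m : ℝ) (h : ℝ → ℝ) (t : ℝ) (f : 𝓢(ℝ, Fin 2 → ℂ)) (i : Fin 2) (x ξ : ℝ) : ℂ :=
  ∑ j, (wave x ξ * (phase m t ξ * (h (dispersion m ξ) * projSymbol m 1 i j ξ) *
          𝓕 (component j f) ξ)
    + wave x (-ξ) * (phase m (-t) (-ξ) * (h (-dispersion m (-ξ)) * projSymbol m (-1) i j (-ξ)) *
          𝓕 (component j f) (-ξ)))

lemma spectral_integrand_eq {m : ℝ} (hm : 0 < m) (h : ℝ → ℝ) (t : ℝ) (f : 𝓢(ℝ, Fin 2 → ℂ))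
    (i : Fin 2) (x : ℝ) {ξ : ℝ} (hξ : ξ ≠ 0) :
    (1 / (2 * (Real.pi : ℂ) * Complex.I)) * (|velocity m ξ| •
      (Complex.exp (-Complex.I * (dispersion m ξ : ℂ) * (t : ℂ)) •
        ((h (dispersion m ξ) : ℝ) : ℂ) •
          ∫ y : ℝ, (Dmat m (dispersion m ξ) (x - y)).mulVec (f y))) i =
      spectralDensity m h t f i x ξ := by
  simp only [Pi.smul_apply]
  rw [integral_Dmat_mulVec_apply m _ x f i (sign_mul_sqrt_dispersion hm hξ), spectralDensity]
  simp only [Finset.smul_sum, Finset.mul_sum]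
  refine Finset.sum_congr rfl fun j _ => ?_
  have hph : Complex.exp (-Complex.I * (dispersion m ξ : ℂ) * (t : ℂ)) = phase m t ξ := by
    rw [phase]
    congr 1
    ring
  have hw : Complex.exp (-((2 * Real.pi * ξ : ℝ) * x * Complex.I)) = wave x (-ξ) := by
    rw [wave]
    congr 1
    push_cast
    ring
  have hΩ : (dispersion m ξ : ℂ) ≠ 0 := mod_cast dispersion_ne_zero hm hξ
  have hξ' : (ξ : ℂ) ≠ 0 := mod_cast hξ
  have hpi : (Real.pi : ℂ) ≠ 0 := mod_cast Real.pi_ne_zero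
  rw [hph, hw, phase_neg, neg_neg, dispersion_neg, neg_neg, ← wave,
    abs_of_pos (velocity_pos hm hξ)]
  simp only [projSymbol, dispersion_neg, velocity, smul_eq_mul,
    Complex.real_smul]
  push_cast
  field_simp
  ring

section Spectral

variable {m ε : ℝ} {h : ℝ → ℝ}

/-- The high-energy part of the free Dirac group, in terms of scalar propagators. -/
def diracPropagator (m : ℝ) (h : ℝ → ℝ) (t : ℝ) (f : 𝓢(ℝ, Fin 2 → ℂ)) (x : ℝ) (i : Fin 2) : ℂ :=
  ∑ j, (propagator m t (fun ξ => h (dispersion m ξ) * projSymbol m 1 i j ξ) (𝓕 (component j f)) x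
    + propagator m (-t) (fun ξ => h (-dispersion m ξ) * projSymbol m (-1) i j ξ)
        (𝓕 (component j f)) x)

/-- Hypotheses on the high-energy cutoff. -/
structure IsHighEnergyCutoff (m ε : ℝ) (h : ℝ → ℝ) : Prop where
  smooth : ContDiff ℝ (⊤ : ℕ∞) h
  bounded : ∀ n, ∃ C, ∀ x, |iteratedDeriv n h x| ≤ C
  low : ∀ ω, |ω| ≤ m + ε → h ω = 0

lemma IsHighEnergyCutoff.comp_neg (hh : IsHighEnergyCutoff m ε h) :
    IsHighEnergyCutoff m ε fun ω => h (-ω) where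
  smooth := hh.smooth.comp contDiff_neg
  bounded n := by
    obtain ⟨C, hC⟩ := hh.bounded n
    refine ⟨C, fun x => ?_⟩
    rw [iteratedDeriv_comp_neg, smul_eq_mul, abs_mul, abs_pow, abs_neg, abs_one, one_pow, one_mul]
    exact hC _
  low ω hω := hh.low _ (by rwa [abs_neg])

namespace IsHighEnergyCutoff

lemma integrable_wave_mul_symbol (hm : 0 < m) (hε : 0 < ε) (hh : IsHighEnergyCutoff m ε h)
    {b : ℝ → ℂ} (hb : IsSymbol m h b) (t x : ℝ) (u : 𝓢(ℝ, ℂ)) :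
    Integrable fun ξ => wave x ξ * (phase m t ξ * (h (dispersion m ξ) * b ξ) * u ξ) := by
  have tg := ((isCutSymbol_cutoff_mul hm hε hh.low hb).mul (.phase t)).hasTemperateGrowth hm
    hh.smooth hh.bounded (by positivity)
  refine (integrable_wave_mul (SchwartzMap.smulLeftCLM ℂ
    (fun ξ => phase m t ξ * (h (dispersion m ξ) * b ξ)) u) x).congr (.of_forall fun ξ => ?_)
  simp only [SchwartzMap.smulLeftCLM_apply_apply tg, smul_eq_mul]

lemma propagator_eq_integral (hm : 0 < m) (hε : 0 < ε) (hh : IsHighEnergyCutoff m ε h)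
    {b : ℝ → ℂ} (hb : IsSymbol m h b) (t x : ℝ) (u : 𝓢(ℝ, ℂ)) :
    propagator m t (fun ξ => h (dispersion m ξ) * b ξ) u x =
      ∫ ξ, wave x ξ * (phase m t ξ * (h (dispersion m ξ) * b ξ) * u ξ) := by
  have tg := ((isCutSymbol_cutoff_mul hm hε hh.low hb).mul (.phase t)).hasTemperateGrowth hm
    hh.smooth hh.bounded (by positivity)
  rw [propagator, fourierInv_schwartz_apply]
  simp only [SchwartzMap.smulLeftCLM_apply_apply tg, smul_eq_mul]

lemma integrable_spectralDensity (hm : 0 < m) (hε : 0 < ε) (hh : IsHighEnergyCutoff m ε h)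
    (t : ℝ) (f : 𝓢(ℝ, Fin 2 → ℂ)) (i : Fin 2) (x : ℝ) :
    Integrable (spectralDensity m h t f i x) := by
  refine integrable_finsetSum _ fun j _ => Integrable.add ?_ ?_
  · exact hh.integrable_wave_mul_symbol hm hε (isSymbol_projSymbol m 1 h i j) t x _
  · exact (hh.comp_neg.integrable_wave_mul_symbol hm hε
      (isSymbol_projSymbol m (-1) _ i j) (-t) x (𝓕 (component j f))).comp_neg

lemma integral_spectralDensity (hm : 0 < m) (hε : 0 < ε) (hh : IsHighEnergyCutoff m ε h)
    (t : ℝ) (f : 𝓢(ℝ, Fin 2 → ℂ)) (i : Fin 2) (x : ℝ) :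
    ∫ ξ, spectralDensity m h t f i x ξ = diracPropagator m h t f x i := by
  have h₁ (j : Fin 2) := hh.integrable_wave_mul_symbol hm hε (isSymbol_projSymbol m 1 h i j) t x
    (𝓕 (component j f))
  have h₂ (j : Fin 2) := hh.comp_neg.integrable_wave_mul_symbol hm hε
    (isSymbol_projSymbol m (-1) _ i j) (-t) x (𝓕 (component j f))
  refine (integral_finsetSum _ fun j _ => (h₁ j).add (h₂ j).comp_neg).trans ?_
  refine Finset.sum_congr rfl fun j _ => ?_
  refine (integral_add (h₁ j) (h₂ j).comp_neg).trans ?_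
  rw [hh.propagator_eq_integral hm hε (isSymbol_projSymbol m 1 h i j),
    hh.comp_neg.propagator_eq_integral hm hε (isSymbol_projSymbol m (-1) _ i j),
    integral_neg_eq_self (fun ξ => wave x ξ * (phase m (-t) ξ *
      (h (-dispersion m ξ) * projSymbol m (-1) i j ξ) * 𝓕 (component j f) ξ))]

end IsHighEnergyCutoff

lemma image_dispersion (hm : 0 < m) (N : ℝ) :
    dispersion m '' {ξ | ξ ≠ 0 ∧ |dispersion m ξ| < N} = {ω | m < |ω| ∧ |ω| < N} := by
  ext ω
  constructor
  · rintro ⟨ξ, ⟨h0, hN⟩, rfl⟩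
    exact ⟨lt_abs_dispersion m h0, hN⟩
  · rintro ⟨hω, hN⟩
    have := dispersion_sign_mul_sqrt hm hω
    refine ⟨_, ⟨fun h0 => ?_, by rwa [this]⟩, this⟩
    rw [h0, dispersion_zero] at this
    rw [← this, abs_zero] at hω
    exact hm.not_gt hω

lemma injOn_dispersion (hm : 0 < m) (N : ℝ) :
    Set.InjOn (dispersion m) {ξ | ξ ≠ 0 ∧ |dispersion m ξ| < N} := by
  rintro ξ ⟨hξ, -⟩ η ⟨hη, -⟩ heq
  have h1 := sign_mul_sqrt_dispersion hm hξ
  rw [heq, sign_mul_sqrt_dispersion hm hη] at h1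
  exact (mul_left_cancel₀ (by positivity) h1).symm

lemma measurable_dispersion (m : ℝ) : Measurable (dispersion m) := by
  unfold dispersion
  have : Measurable Real.sign := by
    unfold Real.sign
    exact Measurable.ite measurableSet_Iio measurable_const
      (Measurable.ite measurableSet_Ioi measurable_const measurable_const)
  fun_prop

lemma measurableSet_frequencies (m N : ℝ) :
    MeasurableSet {ξ | ξ ≠ 0 ∧ |dispersion m ξ| < N} :=
  (measurableSet_singleton 0).compl.inter
    (measurableSet_lt (measurable_dispersion m).abs measurable_const)

lemma IsHighEnergyCutoff.truncated_eq_setIntegral (hm : 0 < m) (hε : 0 < ε)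
    (hh : IsHighEnergyCutoff m ε h) (t : ℝ) (f : 𝓢(ℝ, Fin 2 → ℂ)) (i : Fin 2) (x N : ℝ) :
    ((1 / (2 * (Real.pi : ℂ) * Complex.I)) •
      ∫ ω in {ω : ℝ | m < |ω| ∧ |ω| < N},
        Complex.exp (-Complex.I * (ω : ℂ) * (t : ℂ)) • ((h ω : ℝ) : ℂ) •
          ∫ y : ℝ, (Dmat m ω (x - y)).mulVec (f y)) i =
      ∫ ξ in {ξ | ξ ≠ 0 ∧ |dispersion m ξ| < N}, spectralDensity m h t f i x ξ := by
  have hS := measurableSet_frequencies m N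
  have hc : (1 / (2 * (Real.pi : ℂ) * Complex.I)) ≠ 0 := by
    simp [Real.pi_ne_zero]
  have hint (i : Fin 2) : IntegrableOn (fun ξ => (|velocity m ξ| •
      (Complex.exp (-Complex.I * (dispersion m ξ : ℂ) * (t : ℂ)) •
        ((h (dispersion m ξ) : ℝ) : ℂ) •
          ∫ y : ℝ, (Dmat m (dispersion m ξ) (x - y)).mulVec (f y))) i)
      {ξ | ξ ≠ 0 ∧ |dispersion m ξ| < N} := by
    refine (((hh.integrable_spectralDensity hm hε t f i x).const_mul
      (1 / (2 * (Real.pi : ℂ) * Complex.I))⁻¹).integrableOn).congr_fun (fun ξ hξ => ?_) hS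
    beta_reduce
    rw [← spectral_integrand_eq hm h t f i x hξ.1, inv_mul_cancel_left₀ hc]
  rw [← image_dispersion hm N, integral_image_eq_integral_abs_deriv_smul hS
    (fun ξ hξ => (hasDerivAt_dispersion hm hξ.1).hasDerivWithinAt) (injOn_dispersion hm N),
    Pi.smul_apply, eval_integral hint, smul_eq_mul, ← integral_const_mul]
  exact setIntegral_congr_fun hS fun ξ hξ => spectral_integrand_eq hm h t f i x hξ.1

end Spectral

lemma pi_enorm_le_sum {ι : Type*} [Fintype ι] (v : ι → ℂ) : ‖v‖ₑ ≤ ∑ i, ‖v i‖ₑ := by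
  simp only [enorm_eq_nnnorm]
  rw [← ENNReal.ofNNReal_finsetSum, ENNReal.coe_le_coe, pi_nnnorm_le_iff]
  exact fun i => Finset.single_le_sum (f := fun i => ‖v i‖₊) (fun _ _ => zero_le)
    (Finset.mem_univ i)

/-- A bound for `spectralDensity`, uniform in the position variable. -/
def spectralMajorant (m : ℝ) (h : ℝ → ℝ) (t : ℝ) (f : 𝓢(ℝ, Fin 2 → ℂ)) (i : Fin 2) (ξ : ℝ) :
    ℝ≥0∞ :=
  ∑ j, (‖wave 0 ξ * (phase m t ξ * (h (dispersion m ξ) * projSymbol m 1 i j ξ) *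
          𝓕 (component j f) ξ)‖ₑ
    + ‖wave 0 (-ξ) * (phase m (-t) (-ξ) * (h (-dispersion m (-ξ)) * projSymbol m (-1) i j (-ξ)) *
          𝓕 (component j f) (-ξ))‖ₑ)

lemma enorm_wave (x ξ : ℝ) : ‖wave x ξ‖ₑ = 1 := by
  rw [← ofReal_norm, norm_wave, ENNReal.ofReal_one]

lemma enorm_spectralDensity_le (m : ℝ) (h : ℝ → ℝ) (t : ℝ) (f : 𝓢(ℝ, Fin 2 → ℂ)) (i : Fin 2)
    (x ξ : ℝ) : ‖spectralDensity m h t f i x ξ‖ₑ ≤ spectralMajorant m h t f i ξ := by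
  refine (enorm_sum_le _ _).trans (Finset.sum_le_sum fun j _ => (enorm_add_le _ _).trans_eq ?_)
  rw [enorm_mul (wave x ξ), enorm_mul (wave x (-ξ)), enorm_mul (wave 0 ξ), enorm_mul (wave 0 (-ξ))]
  simp only [enorm_wave]

section Convergence

variable {m ε : ℝ} {h : ℝ → ℝ}

namespace IsHighEnergyCutoff

lemma aemeasurable_spectralMajorant (hm : 0 < m) (hε : 0 < ε) (hh : IsHighEnergyCutoff m ε h)
    (t : ℝ) (f : 𝓢(ℝ, Fin 2 → ℂ)) (i : Fin 2) :
    AEMeasurable (spectralMajorant m h t f i) := by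
  have h₁ (j : Fin 2) := hh.integrable_wave_mul_symbol hm hε (isSymbol_projSymbol m 1 h i j) t 0
    (𝓕 (component j f))
  have h₂ (j : Fin 2) := hh.comp_neg.integrable_wave_mul_symbol hm hε
    (isSymbol_projSymbol m (-1) _ i j) (-t) 0 (𝓕 (component j f))
  exact Finset.aemeasurable_fun_sum _ fun j _ => (h₁ j).1.enorm.add (h₂ j).comp_neg.1.enorm

lemma lintegral_spectralMajorant_ne_top (hm : 0 < m) (hε : 0 < ε)
    (hh : IsHighEnergyCutoff m ε h) (t : ℝ) (f : 𝓢(ℝ, Fin 2 → ℂ)) (i : Fin 2) :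
    ∫⁻ ξ, spectralMajorant m h t f i ξ ≠ ⊤ := by
  have h₁ (j : Fin 2) := hh.integrable_wave_mul_symbol hm hε (isSymbol_projSymbol m 1 h i j) t 0
    (𝓕 (component j f))
  have h₂ (j : Fin 2) := hh.comp_neg.integrable_wave_mul_symbol hm hε
    (isSymbol_projSymbol m (-1) _ i j) (-t) 0 (𝓕 (component j f))
  refine ne_of_eq_of_ne (lintegral_finsetSum' _ fun j _ =>
    (h₁ j).1.enorm.add (h₂ j).comp_neg.1.enorm) (ENNReal.sum_ne_top.2 fun j _ => ?_)
  refine ne_of_eq_of_ne (lintegral_add_left' (h₁ j).1.enorm _) (ENNReal.add_ne_top.2 ?_)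
  exact ⟨(h₁ j).2.ne, (h₂ j).comp_neg.2.ne⟩

/-- The mass of the majorant at frequencies not covered by the truncation at energy `N`. -/
lemma tendsto_setLIntegral_spectralMajorant (hm : 0 < m) (hε : 0 < ε)
    (hh : IsHighEnergyCutoff m ε h) (t : ℝ) (f : 𝓢(ℝ, Fin 2 → ℂ)) (i : Fin 2) :
    Filter.Tendsto (fun N : ℝ => ∫⁻ ξ in {ξ | ξ ≠ 0 ∧ |dispersion m ξ| < N}ᶜ,
      spectralMajorant m h t f i ξ) Filter.atTop (nhds 0) := by
  have hmeas := hh.aemeasurable_spectralMajorant hm hε t f i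
  simp_rw [← fun N => lintegral_indicator (μ := volume) (measurableSet_frequencies m N).compl
    (spectralMajorant m h t f i)]
  rw [← lintegral_zero (α := ℝ) (μ := volume)]
  refine tendsto_lintegral_filter_of_dominated_convergence' (spectralMajorant m h t f i)
    (.of_forall fun N => hmeas.indicator (measurableSet_frequencies m N).compl)
    (.of_forall fun N => .of_forall fun ξ => Set.indicator_le_self _ _ _)
    (hh.lintegral_spectralMajorant_ne_top hm hε t f i) ?_
  filter_upwards [compl_mem_ae_iff.2 (measure_singleton (0 : ℝ))] with ξ hξ
  refine tendsto_const_nhds.congr' ?_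
  filter_upwards [Filter.eventually_gt_atTop |dispersion m ξ|] with N hN
  rw [Set.indicator_of_notMem]
  exact fun hmem => hmem ⟨hξ, hN⟩

lemma enorm_diracPropagator_sub_le (hm : 0 < m) (hε : 0 < ε)
    (hh : IsHighEnergyCutoff m ε h) (t : ℝ) (f : 𝓢(ℝ, Fin 2 → ℂ)) (x N : ℝ) :
    ‖diracPropagator m h t f x - (1 / (2 * (Real.pi : ℂ) * Complex.I)) •
      ∫ ω in {ω : ℝ | m < |ω| ∧ |ω| < N},
        Complex.exp (-Complex.I * (ω : ℂ) * (t : ℂ)) • ((h ω : ℝ) : ℂ) •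
          ∫ y : ℝ, (Dmat m ω (x - y)).mulVec (f y)‖ₑ ≤
      ∑ i, ∫⁻ ξ in {ξ | ξ ≠ 0 ∧ |dispersion m ξ| < N}ᶜ, spectralMajorant m h t f i ξ := by
  refine (pi_enorm_le_sum _).trans (Finset.sum_le_sum fun i _ => ?_)
  rw [Pi.sub_apply, hh.truncated_eq_setIntegral hm hε, ← hh.integral_spectralDensity hm hε,
    ← setIntegral_compl (measurableSet_frequencies m N)
      (hh.integrable_spectralDensity hm hε t f i x)]
  exact (enorm_integral_le_lintegral_enorm _).trans
    (lintegral_mono fun ξ => enorm_spectralDensity_le m h t f i x ξ)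

lemma tendsto_truncated (hm : 0 < m) (hε : 0 < ε) (hh : IsHighEnergyCutoff m ε h)
    {σ : ℝ} (hσ : 1 / 2 < σ) (t : ℝ) (f : 𝓢(ℝ, Fin 2 → ℂ)) :
    Filter.Tendsto (fun N : ℝ =>
      (∫⁻ x : ℝ, ENNReal.ofReal ((1 + x ^ 2) ^ (-σ)) *
        (‖diracPropagator m h t f x - (1 / (2 * (Real.pi : ℂ) * Complex.I)) •
            ∫ ω in {ω : ℝ | m < |ω| ∧ |ω| < N},
              Complex.exp (-Complex.I * (ω : ℂ) * (t : ℂ)) • ((h ω : ℝ) : ℂ) •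
                ∫ y : ℝ, (Dmat m ω (x - y)).mulVec (f y)‖₊ : ℝ≥0∞) ^ 2) ^ (1 / 2 : ℝ))
      Filter.atTop (nhds 0) := by
  set δ : ℝ → ℝ≥0∞ := fun N =>
    ∑ i, ∫⁻ ξ in {ξ | ξ ≠ 0 ∧ |dispersion m ξ| < N}ᶜ, spectralMajorant m h t f i ξ
  have hδ : Filter.Tendsto δ Filter.atTop (nhds 0) := by
    rw [← Finset.sum_const_zero (s := (Finset.univ : Finset (Fin 2)))]
    exact tendsto_finsetSum Finset.univ fun i _ =>
      hh.tendsto_setLIntegral_spectralMajorant hm hε t f i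
  set K := ∫⁻ x : ℝ, ENNReal.ofReal ((1 + x ^ 2) ^ (-σ))
  have hK : K ≠ ⊤ := by
    have := integrable_rpow_neg_one_add_norm_sq (E := ℝ) (μ := volume) (r := 2 * σ)
      (by simp; linarith)
    refine ne_of_eq_of_ne (lintegral_congr fun x => ?_) this.lintegral_lt_top.ne
    rw [Real.norm_eq_abs, sq_abs]
    congr 2
    ring
  have hlim : Filter.Tendsto (fun N => (K * δ N ^ 2) ^ (1 / 2 : ℝ)) Filter.atTop (nhds 0) := by
    have h1 := ENNReal.Tendsto.const_mul (a := K) (ENNReal.Tendsto.pow (n := 2) hδ) (.inr hK)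
    have h2 := h1.ennrpow_const (1 / 2 : ℝ)
    simpa using h2
  refine tendsto_of_tendsto_of_tendsto_of_le_of_le tendsto_const_nhds hlim
    (fun _ => zero_le) fun N => ENNReal.rpow_le_rpow ?_ (by norm_num)
  rw [← lintegral_mul_const _ (by fun_prop)]
  refine lintegral_mono fun x => ?_
  gcongr
  exact hh.enorm_diracPropagator_sub_le hm hε t f x N

end IsHighEnergyCutoff

end Convergence

section Estimate

variable {m ε σ : ℝ} {h : ℝ → ℝ}

lemma eLpNorm_two_eq_lintegral {E : Type*} [NormedAddCommGroup E] (v : ℝ → E) :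
    eLpNorm v 2 volume = (∫⁻ x, (‖v x‖₊ : ℝ≥0∞) ^ 2) ^ (1 / 2 : ℝ) := by
  rw [eLpNorm_eq_lintegral_rpow_enorm_toReal (by norm_num) (by norm_num)]
  simp [enorm_eq_nnnorm]

lemma weighted_lintegral_le_eLpNorm (hσ : 2 ≤ σ) (g : ℝ → Fin 2 → ℂ) :
    (∫⁻ x : ℝ, ENNReal.ofReal ((1 + x ^ 2) ^ (-σ)) * (‖g x‖₊ : ℝ≥0∞) ^ 2) ^ (1 / 2 : ℝ) ≤
      eLpNorm (fun x => weight x ^ 2 • g x) 2 volume := by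
  rw [eLpNorm_two_eq_lintegral]
  refine ENNReal.rpow_le_rpow (lintegral_mono fun x => ?_) (by norm_num)
  have hx : (1 : ℝ) ≤ 1 + x ^ 2 := by nlinarith [sq_nonneg x]
  rw [nnnorm_smul, ENNReal.coe_mul, mul_pow]
  gcongr
  rw [← enorm_eq_nnnorm, ← ofReal_norm, ← ENNReal.ofReal_pow (norm_nonneg _), Real.norm_eq_abs,
    sq_abs, weight_sq, inv_pow, ← Real.rpow_natCast (1 + x ^ 2), ← Real.rpow_neg (by positivity)]
  exact ENNReal.ofReal_le_ofReal (Real.rpow_le_rpow_of_exponent_le hx (by push_cast; linarith))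

lemma eLpNorm_le_weighted_lintegral (hσ : 2 ≤ σ) (f : ℝ → Fin 2 → ℂ) :
    eLpNorm (fun x => (1 + x ^ 2) • f x) 2 volume ≤
      (∫⁻ x : ℝ, ENNReal.ofReal ((1 + x ^ 2) ^ σ) * (‖f x‖₊ : ℝ≥0∞) ^ 2) ^ (1 / 2 : ℝ) := by
  rw [eLpNorm_two_eq_lintegral]
  refine ENNReal.rpow_le_rpow (lintegral_mono fun x => ?_) (by norm_num)
  have hx : (1 : ℝ) ≤ 1 + x ^ 2 := by nlinarith [sq_nonneg x]
  rw [nnnorm_smul, ENNReal.coe_mul, mul_pow]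
  gcongr
  rw [← enorm_eq_nnnorm, ← ofReal_norm, ← ENNReal.ofReal_pow (norm_nonneg _), Real.norm_eq_abs,
    sq_abs, ← Real.rpow_natCast (1 + x ^ 2)]
  exact ENNReal.ofReal_le_ofReal (Real.rpow_le_rpow_of_exponent_le hx (by push_cast; linarith))

lemma eLpNorm_component_le (j : Fin 2) (f : 𝓢(ℝ, Fin 2 → ℂ)) :
    eLpNorm (fun x => (1 + x ^ 2) • component j f x) 2 volume ≤
      eLpNorm (fun x => (1 + x ^ 2) • f x) 2 volume := by
  refine eLpNorm_mono fun x => ?_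
  rw [norm_smul, norm_smul]
  gcongr
  exact norm_le_pi_norm (f x) j

lemma eLpNorm_weight_smul_pi_le {g : ℝ → Fin 2 → ℂ}
    (hg : ∀ i, AEStronglyMeasurable (fun x => weight x ^ 2 • g x i) volume) :
    eLpNorm (fun x => weight x ^ 2 • g x) 2 volume ≤
      ∑ i, eLpNorm (fun x => weight x ^ 2 • g x i) 2 volume := by
  calc eLpNorm (fun x => weight x ^ 2 • g x) 2 volume
      ≤ eLpNorm (∑ i, fun x => ‖weight x ^ 2 • g x i‖) 2 volume := by
        refine eLpNorm_mono_real fun x => ?_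
        rw [Finset.sum_apply]
        refine (pi_norm_le_iff_of_nonneg (by positivity)).2 fun i => ?_
        exact Finset.single_le_sum (f := fun i => ‖weight x ^ 2 • g x i‖)
          (fun _ _ => norm_nonneg _) (Finset.mem_univ i)
    _ ≤ ∑ i, eLpNorm (fun x => ‖weight x ^ 2 • g x i‖) 2 volume :=
        eLpNorm_sum_le (fun i _ => (hg i).norm) one_le_two
    _ = _ := by simp only [eLpNorm_norm]

lemma IsHighEnergyCutoff.eLpNorm_diracPropagator_le (hm : 0 < m) (hε : 0 < ε)
    (hh : IsHighEnergyCutoff m ε h) : ∃ C : ℝ≥0, ∀ t (f : 𝓢(ℝ, Fin 2 → ℂ)),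
      (1 + ‖t‖ₑ ^ 2) * eLpNorm (fun x => weight x ^ 2 • diracPropagator m h t f x) 2 volume ≤
        C * eLpNorm (fun x => (1 + x ^ 2) • f x) 2 volume := by
  have hr : 0 < ε / (2 * Real.pi) := by positivity
  choose C₁ h₁ using fun i j => (isCutSymbol_cutoff_mul hm hε hh.low
    (isSymbol_projSymbol m 1 h i j)).eLpNorm_propagator_fourier_le hm hh.smooth hh.bounded hr
  choose C₂ h₂ using fun i j => (isCutSymbol_cutoff_mul hm hε hh.comp_neg.low
    (isSymbol_projSymbol m (-1) _ i j)).eLpNorm_propagator_fourier_le hm hh.comp_neg.smooth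
      hh.comp_neg.bounded hr
  refine ⟨∑ i, ∑ j, (C₁ i j + C₂ i j), fun t f => ?_⟩
  have cont (u : 𝓢(ℝ, ℂ)) : AEStronglyMeasurable (fun x => weight x ^ 2 • u x) volume :=
    ((continuous_weight.pow 2).smul u.continuous).aestronglyMeasurable
  have hexp (i : Fin 2) : (fun x => weight x ^ 2 • diracPropagator m h t f x i) =
      ∑ j, ((fun x => weight x ^ 2 • propagator m t
          (fun ξ => h (dispersion m ξ) * projSymbol m 1 i j ξ) (𝓕 (component j f)) x)
        + fun x => weight x ^ 2 • propagator m (-t)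
          (fun ξ => h (-dispersion m ξ) * projSymbol m (-1) i j ξ) (𝓕 (component j f)) x) := by
    funext x
    simp only [Finset.sum_apply, Pi.add_apply, diracPropagator, Finset.smul_sum, smul_add]
  have hmeas (i : Fin 2) :
      AEStronglyMeasurable (fun x => weight x ^ 2 • diracPropagator m h t f x i) volume := by
    rw [hexp]
    exact Finset.aestronglyMeasurable_sum _ fun j _ => (cont _).add (cont _)
  refine (mul_le_mul_right (eLpNorm_weight_smul_pi_le hmeas) _).trans ?_
  rw [Finset.mul_sum, ENNReal.ofNNReal_finsetSum, Finset.sum_mul]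
  refine Finset.sum_le_sum fun i _ => ?_
  rw [hexp, ENNReal.ofNNReal_finsetSum, Finset.sum_mul]
  refine (mul_le_mul_right (eLpNorm_sum_le (fun j _ => (cont _).add (cont _)) one_le_two)
    _).trans ?_
  rw [Finset.mul_sum]
  refine Finset.sum_le_sum fun j _ => ?_
  refine (mul_le_mul_right (eLpNorm_add_le (cont _) (cont _) one_le_two) _).trans ?_
  rw [mul_add, ENNReal.coe_add, add_mul (C₁ i j : ℝ≥0∞)]
  refine add_le_add ((h₁ i j t _).trans ?_) ?_
  · exact mul_le_mul_right (eLpNorm_component_le j f) _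
  · have := h₂ i j (-t) (component j f)
    rw [enorm_neg] at this
    exact this.trans (mul_le_mul_right (eLpNorm_component_le j f) _)

lemma one_le_decay_mul (t : ℝ) :
    1 ≤ ENNReal.ofReal (2 * (1 + |t|) ^ (-(3 : ℝ) / 2)) * (1 + ‖t‖ₑ ^ 2) := by
  have ht : (1 : ℝ) ≤ 1 + |t| := by linarith [abs_nonneg t]
  have hsq : (1 : ℝ≥0∞) + ‖t‖ₑ ^ 2 = ENNReal.ofReal (1 + t ^ 2) := by
    rw [ENNReal.ofReal_add zero_le_one (sq_nonneg t), ENNReal.ofReal_one, ← sq_abs t,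
      ENNReal.ofReal_pow (abs_nonneg t), ← Real.norm_eq_abs, ofReal_norm]
  rw [hsq, ← ENNReal.ofReal_mul (by positivity), ENNReal.one_le_ofReal]
  have h1 : ((1 + |t|) ^ 2)⁻¹ ≤ (1 + |t|) ^ (-(3 : ℝ) / 2) := by
    rw [← Real.rpow_natCast, ← Real.rpow_neg (by positivity)]
    exact Real.rpow_le_rpow_of_exponent_le ht (by norm_num)
  have h2 : (1 + |t|) ^ 2 ≤ 2 * (1 + t ^ 2) := by
    nlinarith [sq_nonneg (|t| - 1), sq_abs t]
  calc (1 : ℝ) = ((1 + |t|) ^ 2)⁻¹ * (1 + |t|) ^ 2 := by field_simp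
    _ ≤ (1 + |t|) ^ (-(3 : ℝ) / 2) * (2 * (1 + t ^ 2)) := by gcongr
    _ = _ := by ring

end Estimate

/-- `t^{−3/2}` decay of the high-energy component of the free 1D Dirac group: with a
smooth cutoff `h` vanishing near the spectral edges `±m` and equal to `1` at high
energies, for every `σ > 5/2` there is `C` such that for every Schwartz `f` and
every `t`, the improper spectral integral
`U_h(t)f = (1/2πi) lim_{N→∞} ∫_{m<|ω|<N} e^{−iωt} h(ω) (∫ D_ω(x−y)f(y)dy) dω`
converges in `L²_{−σ}(ℝ;ℂ²)` and `‖U_h(t)f‖_{L²_{−σ}} ≤ C(1+|t|)^{−3/2}‖f‖_{L²_σ}`. -/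
theorem free_dirac_high_energy_decay (m ε : ℝ) (hm : 0 < m) (hε : 0 < ε)
    (h : ℝ → ℝ) (hsmooth : ContDiff ℝ (⊤ : ℕ∞) h)
    (hrange : ∀ ω, 0 ≤ h ω ∧ h ω ≤ 1)
    (hlow : ∀ ω, |ω| ≤ m + ε → h ω = 0)
    (hhigh : ∀ ω, m + 2 * ε ≤ |ω| → h ω = 1)
    (σ : ℝ) (hσ : 5 / 2 < σ) :
    ∃ C : ℝ, 0 < C ∧ ∀ f : SchwartzMap ℝ (Fin 2 → ℂ), ∀ t : ℝ,
      ∃ g : ℝ → Fin 2 → ℂ,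
        Filter.Tendsto (fun N : ℝ =>
            (∫⁻ x : ℝ, ENNReal.ofReal ((1 + x ^ 2) ^ (-σ)) *
              (‖g x - (1 / (2 * (Real.pi : ℂ) * Complex.I)) •
                  ∫ ω in {ω : ℝ | m < |ω| ∧ |ω| < N},
                    Complex.exp (-Complex.I * (ω : ℂ) * (t : ℂ)) • ((h ω : ℝ) : ℂ) •
                      ∫ y : ℝ, (Dmat m ω (x - y)).mulVec (f y)‖₊ : ℝ≥0∞) ^ 2)
              ^ (1 / 2 : ℝ))
          Filter.atTop (nhds 0) ∧
        (∫⁻ x : ℝ, ENNReal.ofReal ((1 + x ^ 2) ^ (-σ)) * (‖g x‖₊ : ℝ≥0∞) ^ 2) ^ (1 / 2 : ℝ)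
          ≤ ENNReal.ofReal (C * (1 + |t|) ^ (-(3 : ℝ) / 2)) *
            (∫⁻ x : ℝ, ENNReal.ofReal ((1 + x ^ 2) ^ σ) * (‖f x‖₊ : ℝ≥0∞) ^ 2)
              ^ (1 / 2 : ℝ) := by
  have hh : IsHighEnergyCutoff m ε h :=
    ⟨hsmooth, exists_bound_iteratedDeriv hsmooth hhigh, hlow⟩
  obtain ⟨C, hC⟩ := hh.eLpNorm_diracPropagator_le hm hε
  refine ⟨2 * C + 1, by positivity, fun f t => ⟨diracPropagator m h t f,
    hh.tendsto_truncated hm hε (by linarith) t f, ?_⟩⟩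
  refine (weighted_lintegral_le_eLpNorm (by linarith) _).trans ?_
  refine le_trans ?_ (mul_le_mul_right (eLpNorm_le_weighted_lintegral (by linarith) f) _)
  have hdecay : 0 ≤ (1 + |t|) ^ (-(3 : ℝ) / 2) := by positivity
  calc eLpNorm (fun x => weight x ^ 2 • diracPropagator m h t f x) 2 volume
      ≤ ENNReal.ofReal (2 * (1 + |t|) ^ (-(3 : ℝ) / 2)) * (1 + ‖t‖ₑ ^ 2) *
          eLpNorm (fun x => weight x ^ 2 • diracPropagator m h t f x) 2 volume :=
        le_mul_of_one_le_left (zero_le) (one_le_decay_mul t)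
    _ ≤ ENNReal.ofReal (2 * (1 + |t|) ^ (-(3 : ℝ) / 2)) *
          (C * eLpNorm (fun x => (1 + x ^ 2) • f x) 2 volume) := by
        rw [mul_assoc]
        exact mul_le_mul_right (hC t f) _
    _ = ENNReal.ofReal (2 * (1 + |t|) ^ (-(3 : ℝ) / 2) * C) *
          eLpNorm (fun x => (1 + x ^ 2) • f x) 2 volume := by
        rw [← mul_assoc, ENNReal.ofReal_mul (q := (C : ℝ)) (by positivity),
          ENNReal.ofReal_coe_nnreal]
    _ ≤ _ := by
        refine mul_le_mul_left (ENNReal.ofReal_le_ofReal ?_) _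
        linarith
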